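/- Let f: 𝕋^n → 𝕋^n be a non-invertible, Haar-measure-preserving covering map and U a connected open invariant region (f^{-1}(U) = U). Let S be the linear span in ℝ^n of the image i_#(π₁(U)) ⊆ ℤ^n under the inclusion-induced map. Then S is invariant under the linear part A_f of f, and |det(A_f|_S)| = |det(A_f)|. -/

import Mathlib

open MeasureTheory

lemma aux_alg {n : ℕ} (A : Matrix (Fin n) (Fin n) ℤ) (L : Submodule ℤ (Fin n → ℤ))
    (hinv : ∀ v ∈ L, A.mulVec v ∈ L) (hsurj : ∀ w, ∃ u, w - A.mulVec u ∈ L)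
    (S : Submodule ℝ (Fin n → ℝ))
    (hS : S = Submodule.span ℝ ((fun v : Fin n → ℤ => fun i => ((v i : ℝ))) '' (L : Set (Fin n → ℤ)))) :
    ∃ hSinv : ∀ v ∈ S, Matrix.toLin' (A.map (Int.cast : ℤ → ℝ)) v ∈ S,
      |LinearMap.det ((Matrix.toLin' (A.map (Int.cast : ℤ → ℝ))).restrict hSinv)| =
        |(A.map (Int.cast : ℤ → ℝ)).det| := by
  classical
  obtain ⟨k, bM, bN, g, a, snf⟩ := L.smithNormalForm (Pi.basisFun ℤ (Fin n))
  set T := Matrix.toLin' (A.map (Int.cast : ℤ → ℝ)) with hT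
  set c : (Fin n → ℤ) → (Fin n → ℝ) := fun v => fun i => ((v i : ℝ)) with hc
  have hcm : ∀ (B : Matrix (Fin n) (Fin n) ℤ) v, (B.map (Int.cast : ℤ → ℝ)).mulVec (c v) = c (B.mulVec v) := by
    intro B v
    ext i
    simp [hc, Matrix.mulVec, dotProduct]
  have hTc : ∀ v, T (c v) = c (A.mulVec v) := by
    intro v
    rw [hT, Matrix.toLin'_apply, hcm]
  have hSinv : ∀ v ∈ S, T v ∈ S := by
    have : S ≤ S.comap T := by
      conv_lhs => rw [hS]
      rw [Submodule.span_le]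
      rintro _ ⟨v, hv, rfl⟩
      show T (c v) ∈ S
      rw [hTc, hS]
      exact Submodule.subset_span ⟨_, hinv v hv, rfl⟩
    exact this
  refine ⟨hSinv, ?_⟩
  -- real basis
  obtain ⟨b, hb⟩ : ∃ b : Module.Basis (Fin n) ℝ (Fin n → ℝ),
      ∀ v i, b.repr (c v) i = (bM.repr v i : ℝ) := by
    let P := (Pi.basisFun ℤ (Fin n)).toMatrix bM
    let Q := bM.toMatrix (Pi.basisFun ℤ (Fin n))
    have hPQ : P * Q = 1 := Module.Basis.toMatrix_mul_toMatrix_flip _ _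
    have hQP : Q * P = 1 := Module.Basis.toMatrix_mul_toMatrix_flip _ _
    have h1 : (P.map (Int.cast : ℤ → ℝ)) * (Q.map (Int.cast : ℤ → ℝ)) = 1 := by
      have := congrArg (fun M => (Int.castRingHom ℝ).mapMatrix M) hPQ
      rw [map_mul, map_one] at this
      exact this
    have h2 : (Q.map (Int.cast : ℤ → ℝ)) * (P.map (Int.cast : ℤ → ℝ)) = 1 := by
      have := congrArg (fun M => (Int.castRingHom ℝ).mapMatrix M) hQP
      rw [map_mul, map_one] at this
      exact this
    refine ⟨Module.Basis.ofEquivFun (Matrix.toLin'OfInv h1 h2), fun v i => ?_⟩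
    have h3 : Q.mulVec v = bM.repr v := by
      have := Module.Basis.toMatrix_mulVec_repr (Pi.basisFun ℤ (Fin n)) bM v
      rw [← this]
      congr 1
    rw [Module.Basis.ofEquivFun_repr_apply]
    have h4 : (Matrix.toLin'OfInv h1 h2) (c v) = (Q.map (Int.cast : ℤ → ℝ)).mulVec (c v) := by
      simp [Matrix.toLin'OfInv]
    rw [h4, hcm, h3]
  have hbi : ∀ i, b i = c (bM i) := by
    intro i
    apply b.repr.injective
    ext j
    rw [hb]
    simp [Finsupp.single_apply]
  have hLrepr : ∀ v ∈ L, ∀ i, i ∉ Set.range g → bM.repr v i = 0 := by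
    intro v hv i hi
    exact Module.Basis.SmithNormalForm.repr_eq_zero_of_notMem_range
      (⟨bM, bN, g, a, snf⟩ : Module.Basis.SmithNormalForm L (Fin n) k) ⟨v, hv⟩ hi
  obtain ⟨p, hp⟩ : ∃ p : Fin n → Prop, ∀ i, p i ↔ i ∈ Set.range g := ⟨_, fun _ => Iff.rfl⟩
  have hSb : S = Submodule.span ℝ (Set.range (fun i : {i // p i} => b i)) := by
    apply le_antisymm
    · rw [hS, Submodule.span_le]
      rintro _ ⟨v, hv, rfl⟩
      show c v ∈ _
      rw [← b.sum_repr (c v)]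
      refine Submodule.sum_mem _ fun i _ => ?_
      by_cases hi : i ∈ Set.range g
      · exact Submodule.smul_mem _ _ (Submodule.subset_span ⟨⟨i, (hp i).2 hi⟩, rfl⟩)
      · rw [hb, hLrepr v hv i hi]
        simp
    · rw [Submodule.span_le]
      rintro _ ⟨⟨i, hi⟩, rfl⟩
      obtain ⟨j, rfl⟩ := (hp i).1 hi
      show b (g j) ∈ S
      have ha : (a j : ℝ) ≠ 0 := by
        have : a j ≠ 0 := by
          intro h
          have h2 := snf j
          rw [h, zero_smul] at h2
          exact bN.ne_zero j (Subtype.ext h2)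
        exact_mod_cast this
      have h1 : (a j : ℝ) • b (g j) ∈ S := by
        have : (a j : ℝ) • b (g j) = c (bN j) := by
          rw [snf j, hbi]
          ext i
          simp [hc]
        rw [this, hS]
        exact Submodule.subset_span ⟨_, (bN j).2, rfl⟩
      simpa [smul_smul, inv_mul_cancel₀ ha] using S.smul_mem ((a j : ℝ)⁻¹) h1
  have hli : LinearIndependent ℝ (fun i : {i // p i} => b i) :=
    b.linearIndependent.comp _ Subtype.val_injective
  let bS : Module.Basis {i // p i} ℝ S :=
    (Module.Basis.span hli).map (LinearEquiv.ofEq _ _ hSb.symm)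
  have hbS : ∀ i, (bS i : Fin n → ℝ) = b i := by
    intro i
    simp [bS, Module.Basis.span_apply]
  have hbSr : ∀ (x : S) (i : {i // p i}), bS.repr x i = b.repr (x : Fin n → ℝ) i := by
    intro x i
    conv_rhs => rw [← bS.sum_repr x]
    simp only [Submodule.coe_sum, Submodule.coe_smul, hbS, map_sum, map_smul,
      Finsupp.finsetSum_apply]
    simp [Finsupp.single_apply, Subtype.val_inj]
  have hSr : ∀ x ∈ S, ∀ i, ¬ p i → b.repr x i = 0 := by
    intro x hx i hi
    have : x = ((⟨x, hx⟩ : S) : Fin n → ℝ) := rfl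
    rw [this, ← bS.sum_repr ⟨x, hx⟩]
    simp only [Submodule.coe_sum, Submodule.coe_smul, hbS, map_sum, map_smul, Finsupp.finsetSum_apply]
    refine Finset.sum_eq_zero fun j _ => ?_
    have : (j : Fin n) ≠ i := fun h => hi (h ▸ j.2)
    simp [Finsupp.single_apply, this]
  let M := LinearMap.toMatrix b b T
  have hM : ∀ i j, M i j = (bM.repr (A.mulVec (bM j)) i : ℝ) := by
    intro i j
    simp only [M]
    rw [LinearMap.toMatrix_apply, hbi, hTc, hb]
  have hblock : ∀ i, ¬p i → ∀ j, p j → M i j = 0 := by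
    intro i hi j hj
    simp only [M]
    rw [LinearMap.toMatrix_apply]
    refine hSr _ (hSinv _ ?_) i hi
    rw [← hbS ⟨j, hj⟩]
    exact (bS ⟨j, hj⟩).2
  have hdet := Matrix.twoBlockTriangular_det M p hblock
  have h1 : M.det = (A.map (Int.cast : ℤ → ℝ)).det := by
    rw [LinearMap.det_toMatrix, hT, LinearMap.det_toLin']
  have h2 : (M.toSquareBlockProp p).det = LinearMap.det (T.restrict hSinv) := by
    rw [← LinearMap.det_toMatrix bS]
    congr 1
    ext i j
    rw [LinearMap.toMatrix_apply, hbSr, LinearMap.coe_restrict_apply, hbS]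
    simp [Matrix.toSquareBlockProp_def, M, LinearMap.toMatrix_apply]
  let D : Matrix {i // ¬ p i} {i // ¬ p i} ℤ := fun i j => bM.repr (A.mulVec (bM j)) i
  have h3 : (M.toSquareBlockProp fun i => ¬ p i) = D.map (Int.cast : ℤ → ℝ) := by
    ext i j
    simp [Matrix.toSquareBlockProp_def, hM, D, Matrix.map_apply]
    try rfl
  choose u hu using hsurj
  let E : Matrix {i // ¬ p i} {i // ¬ p i} ℤ := fun l j => bM.repr (u (bM j)) l
  have hDE : D * E = 1 := by
    ext i j
    have hz := hLrepr _ (hu (bM j)) i (fun h => i.2 ((hp _).2 h))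
    rw [map_sub, Finsupp.sub_apply, sub_eq_zero] at hz
    have hexp : bM.repr (A.mulVec (u (bM j))) i
        = ∑ l, bM.repr (u (bM j)) l * bM.repr (A.mulVec (bM l)) i := by
      conv_lhs => rw [← bM.sum_repr (u (bM j))]
      rw [← Matrix.mulVecLin_apply]
      simp only [map_sum, map_smul, Finsupp.finsetSum_apply, Finsupp.smul_apply, smul_eq_mul, Matrix.mulVecLin_apply]
    have hzero : ∀ l, p l → bM.repr (A.mulVec (bM l)) i = 0 := by
      intro l hl
      have := hblock i i.2 l hl
      rw [hM] at this
      exact_mod_cast this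
    rw [Matrix.mul_apply]
    have hsub : ∑ l, bM.repr (u (bM j)) l * bM.repr (A.mulVec (bM l)) i
        = ∑ l : {l // ¬ p l}, bM.repr (u (bM j)) l * bM.repr (A.mulVec (bM l)) i := by
      rw [← Fintype.sum_subtype_add_sum_subtype p]
      rw [Finset.sum_eq_zero (fun l _ => by rw [hzero l l.2, mul_zero]), zero_add]
    rw [hexp, hsub] at hz
    simp only [D, E]
    rw [Finset.sum_congr rfl (fun l _ => mul_comm _ _), ← hz]
    simp [Finsupp.single_apply, Matrix.one_apply, Subtype.ext_iff, eq_comm]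
  have hDu : |((D.map (Int.cast : ℤ → ℝ)).det)| = 1 := by
    have : IsUnit D.det := IsUnit.of_mul_eq_one E.det (by rw [← Matrix.det_mul, hDE, Matrix.det_one])
    have h5 : (D.map (Int.cast : ℤ → ℝ)).det = (D.det : ℝ) := (Int.cast_det D).symm
    rw [h5]
    rcases Int.isUnit_iff.1 this with h | h <;> simp [h]
  rw [← h1, hdet, abs_mul, h2, h3, hDu, mul_one]

open unitInterval in
lemma aux_lift {n : ℕ} (δ : C(I, Fin n → AddCircle (1 : ℝ))) (x : Fin n → ℝ)
    (hx : ∀ i, δ 0 i = (x i : AddCircle (1 : ℝ))) :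
    ∃ γ : C(I, Fin n → ℝ), γ 0 = x ∧ ∀ t i, ((γ t i : ℝ) : AddCircle (1 : ℝ)) = δ t i := by
  have hc := AddCircle.isCoveringMap_coe (1 : ℝ)
  let d : Fin n → C(I, AddCircle (1 : ℝ)) := fun i => ⟨fun t => δ t i, by fun_prop⟩
  refine ⟨⟨fun t i => hc.liftPath (d i) (x i) (hx i) t, by fun_prop⟩, ?_, ?_⟩
  · ext i
    exact hc.liftPath_zero (d i) (x i) (hx i)
  · intro t i
    exact congrFun (hc.liftPath_lifts (d i) (x i) (hx i)) t

open unitInterval in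
lemma aux_unique {n : ℕ} (γ γ' : I → Fin n → ℝ) (h : Continuous γ) (h' : Continuous γ')
    (h0 : γ 0 = γ' 0)
    (he : ∀ t i, ((γ t i : ℝ) : AddCircle (1 : ℝ)) = ((γ' t i : ℝ) : AddCircle (1 : ℝ))) :
    γ = γ' := by
  have hc := AddCircle.isCoveringMap_coe (1 : ℝ)
  funext t i
  have := hc.eq_of_comp_eq (g₁ := fun t => γ t i) (g₂ := fun t => γ' t i) (by fun_prop)
    (by fun_prop) (by funext t; exact he t i) 0 (by simp [h0])
  exact congrFun this t

lemma aux_int {n : ℕ} (x y : Fin n → ℝ)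
    (h : ∀ i, (x i : AddCircle (1 : ℝ)) = (y i : AddCircle (1 : ℝ))) :
    ∃ u : Fin n → ℤ, x = y + fun i => (u i : ℝ) := by
  have : ∀ i, ∃ m : ℤ, x i = y i + m := by
    intro i
    have h1 : ((x i - y i : ℝ) : AddCircle (1 : ℝ)) = 0 := by
      rw [AddCircle.coe_sub, h i, sub_self]
    obtain ⟨m, hm⟩ := (AddCircle.coe_eq_zero_iff (1 : ℝ)).1 h1
    refine ⟨m, ?_⟩
    simp at hm
    linarith
  choose u hu using this
  exact ⟨u, funext hu⟩

lemma aux_locPath (n : ℕ) : LocallyPathConnectedSpace (Fin n → AddCircle (1 : ℝ)) := by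
  have h : IsOpenQuotientMap (Pi.map (fun (_ : Fin n) (x : ℝ) => (x : AddCircle (1 : ℝ)))) :=
    IsOpenQuotientMap.piMap fun _ => QuotientAddGroup.isOpenQuotientMap_mk
  exact h.isQuotientMap.locallyPathConnectedSpace

/-- Main lemma: let `f : 𝕋ⁿ → 𝕋ⁿ` be a non-invertible Haar-measure-preserving covering
map, `U` a connected open invariant region, and `Λ ⊆ ℤⁿ` the image `i_#(π₁(U))` of the
fundamental group of `U` in `π₁(𝕋ⁿ) ≅ ℤⁿ` (described by deck translations: `v ∈ Λ` iff
some path from `x̂₀` to `x̂₀ + v` projects into `U`). If `S` is the real span of `Λ`,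
then `S` is invariant under the linear part `A_f` and `|det(A_f|_S)| = |det(A_f)|`. -/
theorem span_pi1_invariant_and_det_eq
    (n : ℕ)
    (p : (Fin n → ℝ) → (Fin n → AddCircle (1 : ℝ)))
    (hp : ∀ x i, p x i = (x i : AddCircle (1 : ℝ)))
    (f : (Fin n → AddCircle (1 : ℝ)) → (Fin n → AddCircle (1 : ℝ)))
    (hcov : IsCoveringMap f) (hnoninv : ¬ Function.Injective f)
    (hpres : MeasurePreserving f volume volume)
    (U : Set (Fin n → AddCircle (1 : ℝ)))
    (hUopen : IsOpen U) (hUconn : IsConnected U) (hUinv : f ⁻¹' U = U)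
    (x₀ : Fin n → ℝ) (hx₀ : p x₀ ∈ U)
    (fhat : (Fin n → ℝ) → (Fin n → ℝ)) (hfhatcont : Continuous fhat)
    (hlift : p ∘ fhat = f ∘ p)
    (A : Matrix (Fin n) (Fin n) ℤ)
    (hA : ∀ (x : Fin n → ℝ) (v : Fin n → ℤ),
      fhat (x + fun i => (v i : ℝ)) = fhat x + fun i => ((A.mulVec v) i : ℝ))
    (Lam : Set (Fin n → ℤ))
    (hLam : Lam = {v : Fin n → ℤ |
      ∃ γ : Path x₀ (x₀ + fun i => (v i : ℝ)), ∀ t, p (γ t) ∈ U})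
    (S : Submodule ℝ (Fin n → ℝ))
    (hS : S = Submodule.span ℝ ((fun v : Fin n → ℤ => fun i => ((v i : ℝ))) '' Lam)) :
    ∃ hSinv : ∀ v ∈ S, Matrix.toLin' (A.map (Int.cast : ℤ → ℝ)) v ∈ S,
      |LinearMap.det ((Matrix.toLin' (A.map (Int.cast : ℤ → ℝ))).restrict hSinv)| =
        |(A.map (Int.cast : ℤ → ℝ)).det| := by
  have hpc : Continuous p := by
    have : p = fun x i => (x i : AddCircle (1 : ℝ)) := by
      funext x i
      exact hp x i
    rw [this]
    refine continuous_pi fun i => ?_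
    exact (AddCircle.isCoveringMap_coe (1 : ℝ)).continuous.comp (continuous_apply i)
  let c : (Fin n → ℤ) → (Fin n → ℝ) := fun v i => (v i : ℝ)
  have hcadd : ∀ u v, c (u + v) = c u + c v := by
    intro u v
    ext i
    simp [c]
  have hcneg : ∀ u, c (-u) = - c u := by
    intro u
    ext i
    simp [c]
  have hpadd : ∀ x v, p (x + c v) = p x := by
    intro x v
    funext i
    rw [hp, hp]
    have : ((v i : ℝ) : AddCircle (1 : ℝ)) = 0 :=
      (AddCircle.coe_eq_zero_iff (1 : ℝ)).2 ⟨v i, by simp⟩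
    simp [c, this]
  let V : Set (Fin n → ℝ) := p ⁻¹' U
  have hpint : ∀ x y, p x = p y → ∃ u, x = y + c u := by
    intro x y h
    exact aux_int x y fun i => by rw [← hp, ← hp, h]
  have htr : ∀ x y v, JoinedIn V x y → JoinedIn V (x + c v) (y + c v) := by
    intro x y v h
    refine (h.map (f := fun z => z + c v) (by fun_prop)).mono ?_
    rintro _ ⟨z, hz, rfl⟩
    show p (z + c v) ∈ U
    rw [hpadd]
    exact hz
  have hfU : ∀ x, f x ∈ U ↔ x ∈ U := by
    intro x
    exact Set.ext_iff.1 hUinv x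
  have hlift1 : ∀ x, p (fhat x) = f (p x) := fun x => congrFun hlift x
  have hfh : ∀ x y, JoinedIn V x y → JoinedIn V (fhat x) (fhat y) := by
    intro x y h
    refine (h.map hfhatcont).mono ?_
    rintro _ ⟨z, hz, rfl⟩
    show p (fhat z) ∈ U
    rw [hlift1, hfU]
    exact hz
  -- every point of `V` is joined to a translate of `y`
  have hjoin : ∀ x ∈ V, ∀ y ∈ V, ∃ u, JoinedIn V x (y + c u) := by
    intro x hx y hy
    haveI := aux_locPath n
    have hUp : IsPathConnected U := hUopen.isConnected_iff_isPathConnected.1 hUconn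
    obtain ⟨δ, hδ⟩ := hUp.joinedIn (p x) hx (p y) hy
    obtain ⟨γ, h0, h1⟩ := aux_lift δ.toContinuousMap x (fun i => by
      rw [← hp]
      exact congrFun δ.source i)
    have h2 : ∀ t, p (γ t) = δ t := by
      intro t
      funext i
      rw [hp, h1]
      rfl
    obtain ⟨u, hu⟩ := hpint (γ 1) y (by rw [h2, δ.target])
    exact ⟨u, ⟨⟨γ, h0, hu⟩, fun t => by
      show p (γ t) ∈ U
      rw [h2]
      exact hδ t⟩⟩
  have hmem : ∀ v, v ∈ Lam ↔ JoinedIn V x₀ (x₀ + c v) := by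
    intro v
    rw [hLam]
    exact Iff.rfl
  -- change of base point
  have hbase : ∀ y ∈ V, ∀ v, JoinedIn V y (y + c v) → v ∈ Lam := by
    intro y hy v h
    obtain ⟨u, hu⟩ := hjoin x₀ hx₀ y hy
    rw [hmem]
    refine hu.trans (JoinedIn.trans ?_ (htr _ _ v hu).symm)
    have := htr _ _ u h
    rwa [add_right_comm] at this
  let L : Submodule ℤ (Fin n → ℤ) := AddSubgroup.toIntSubmodule
    { carrier := Lam
      zero_mem' := by
        rw [hmem]
        have : x₀ + c 0 = x₀ := by
          ext i
          simp [c]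
        rw [this]
        exact JoinedIn.refl hx₀
      add_mem' := by
        intro u v hu hv
        rw [hmem] at *
        rw [hcadd, ← add_assoc]
        exact hv.trans (htr _ _ v hu)
      neg_mem' := by
        intro u hu
        rw [hmem] at *
        have := (htr _ _ (-u) hu).symm
        rwa [hcneg, add_neg_cancel_right, ← hcneg] at this }
  have hLmem : ∀ v, v ∈ L ↔ v ∈ Lam := fun v => Iff.rfl
  have hfx₀ : fhat x₀ ∈ V := by
    show p (fhat x₀) ∈ U
    rw [hlift1, hfU]
    exact hx₀
  refine aux_alg A L ?_ ?_ S hS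
  · intro v hv
    rw [hLmem] at *
    refine hbase (fhat x₀) hfx₀ _ ?_
    have := hfh _ _ ((hmem v).1 hv)
    have h2 : fhat (x₀ + c v) = fhat x₀ + c (A.mulVec v) := hA x₀ v
    rwa [h2] at this
  · intro w
    -- find y with fhat y = fhat x₀ + w
    obtain ⟨y, hy⟩ : ∃ y, fhat y = fhat x₀ + c w := by
      let σ : C(unitInterval, Fin n → ℝ) :=
        ⟨fun t => fhat x₀ + (t : ℝ) • c w, by fun_prop⟩
      let τ : C(unitInterval, Fin n → AddCircle (1 : ℝ)) := ⟨fun t => p (σ t), by fun_prop⟩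
      have hτ0 : τ 0 = f (p x₀) := by
        simp [τ, σ, hlift1]
      let δ := hcov.liftPath τ (p x₀) hτ0
      have hδ0 : δ 0 = p x₀ := hcov.liftPath_zero τ (p x₀) hτ0
      have hδ : ∀ t, f (δ t) = τ t := congrFun (hcov.liftPath_lifts τ (p x₀) hτ0)
      obtain ⟨γ, h0, h1⟩ := aux_lift δ x₀ (fun i => by rw [hδ0, hp])
      have h2 : ∀ t, p (γ t) = δ t := by
        intro t
        funext i
        rw [hp, h1]
      have h3 : (fun t => fhat (γ t)) = fun t => σ t := by
        apply aux_unique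
        · fun_prop
        · fun_prop
        · simp [h0, σ]
        · intro t i
          rw [← hp, ← hp, hlift1, h2, hδ]
          rfl
      refine ⟨γ 1, ?_⟩
      have := congrFun h3 1
      simpa [σ] using this
    have hyV : y ∈ V := by
      show p y ∈ U
      rw [← hfU, ← hlift1, hy, hpadd]
      exact hfx₀
    obtain ⟨u, hu⟩ := hjoin y hyV x₀ hx₀
    refine ⟨u, ?_⟩
    rw [hLmem]
    refine hbase (fhat x₀) hfx₀ _ ?_
    have h4 := hfh _ _ hu
    have h2 : fhat (x₀ + c u) = fhat x₀ + c (A.mulVec u) := hA x₀ u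
    rw [h2, hy] at h4
    have h5 := (htr _ _ (-(A.mulVec u)) h4).symm
    rw [hcneg, add_neg_cancel_right, add_assoc, ← hcneg, ← hcadd, ← sub_eq_add_neg] at h5
    exact h5
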